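/- Let β ∈ Φ⁺ be a positive root and i an index with s_i(β) − β ∈ ℝ_{>0}·α_i. Then the set of rank two subsystems cutting (s_i(β))^⊥ equals the union of: (1) the set of subsystems of the form s_i(R), where R is a rank two subsystem cutting β^⊥; and (2) the single rank two subsystem Φ ∩ span_ℝ(α_i, β). -/

import Mathlib

/-!
Setup: a symmetrizable crystallographic Cartan matrix `A` with symmetrizers `d`,
the vector space `V = Fin n → ℝ` with standard basis `α i = Pi.single i 1`,
the bilinear form `(α i, α j) = d i * A i j`, the simple reflections
`s i (x) = x - (dᵢ⁻¹ αᵢ, x) αᵢ`, the group `W` generated by them (elements of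
which are represented as products of lists of simple reflections), and the
set of real roots `Φ = { w (α i) }`.
-/

open Finset

noncomputable section

/-- The simple root `α i`, i.e. the `i`-th standard basis vector of `ℝⁿ`. -/
def sroot (n : ℕ) (i : Fin n) : Fin n → ℝ := Pi.single i 1

/-- The symmetric bilinear form with `(α i, α j) = d i * A i j`. -/
def formL (n : ℕ) (d : Fin n → ℤ) (A : Fin n → Fin n → ℤ) :
    (Fin n → ℝ) →ₗ[ℝ] (Fin n → ℝ) →ₗ[ℝ] ℝ :=
  ∑ i : Fin n, ∑ j : Fin n,
    ((d i * A i j : ℤ) : ℝ) •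
      LinearMap.smulRight (LinearMap.proj i : (Fin n → ℝ) →ₗ[ℝ] ℝ)
        (LinearMap.proj j : (Fin n → ℝ) →ₗ[ℝ] ℝ)

/-- The simple reflection `s i`, given by `s i x = x - (dᵢ⁻¹ • αᵢ, x) • αᵢ`. -/
def simpleRefl (n : ℕ) (d : Fin n → ℤ) (A : Fin n → Fin n → ℤ) (i : Fin n) :
    Module.End ℝ (Fin n → ℝ) :=
  LinearMap.id - ((d i : ℝ)⁻¹) • (formL n d A (sroot n i)).smulRight (sroot n i)

/-- The element `s i_r * ⋯ * s i_1` of `W` corresponding to the list `l = [i_1, …, i_r]`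
(the reflection `s i_1` is applied first). -/
def wprod (n : ℕ) (d : Fin n → ℤ) (A : Fin n → Fin n → ℤ) (l : List (Fin n)) :
    Module.End ℝ (Fin n → ℝ) :=
  ((l.map (simpleRefl n d A)).reverse).prod

/-- `β` is a real root: `β = w (α i)` for some `w ∈ W` and some `i`. -/
def IsRoot (n : ℕ) (d : Fin n → ℤ) (A : Fin n → Fin n → ℤ) (β : Fin n → ℝ) : Prop :=
  ∃ (l : List (Fin n)) (i : Fin n), β = wprod n d A l (sroot n i)

/-- `β` is a positive root: a real root all of whose coordinates are `≥ 0`. -/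
def IsPosRoot (n : ℕ) (d : Fin n → ℤ) (A : Fin n → Fin n → ℤ) (β : Fin n → ℝ) : Prop :=
  IsRoot n d A β ∧ ∀ k, 0 ≤ β k

/-- `β` is a negative root: a real root all of whose coordinates are `≤ 0`. -/
def IsNegRoot (n : ℕ) (d : Fin n → ℤ) (A : Fin n → Fin n → ℤ) (β : Fin n → ℝ) : Prop :=
  IsRoot n d A β ∧ ∀ k, β k ≤ 0

/-- The reflection `t_β` along a root `β`: `t_β x = x - (β^∨, x) • β` where
`β^∨ = d_β⁻¹ • β` and `d_β = (β, β)/2`. -/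
def reflAlong (n : ℕ) (d : Fin n → ℤ) (A : Fin n → Fin n → ℤ) (β : Fin n → ℝ) :
    Module.End ℝ (Fin n → ℝ) :=
  LinearMap.id - (2 / formL n d A β β) • (formL n d A β).smulRight β

/-- `R` is a rank two subsystem: `R = Φ ∩ L` for a two-dimensional subspace `L`
which is spanned by `R`. -/
def IsRankTwo (n : ℕ) (d : Fin n → ℤ) (A : Fin n → Fin n → ℤ)
    (R : Set (Fin n → ℝ)) : Prop :=
  ∃ L : Submodule ℝ (Fin n → ℝ), Module.finrank ℝ L = 2 ∧
    R = {γ | IsRoot n d A γ} ∩ (L : Set (Fin n → ℝ)) ∧ Submodule.span ℝ R = L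

/-- `β` is a fundamental root of `R`: it is a positive root of `R` and there is a
second positive root `β'` of `R` such that every positive root of `R` is a
nonnegative combination of `β` and `β'`. -/
def IsFundamentalIn (n : ℕ) (d : Fin n → ℤ) (A : Fin n → Fin n → ℤ)
    (R : Set (Fin n → ℝ)) (β : Fin n → ℝ) : Prop :=
  β ∈ R ∧ IsPosRoot n d A β ∧
    ∃ β' ∈ R, IsPosRoot n d A β' ∧ β' ≠ β ∧
      ∀ γ ∈ R, IsPosRoot n d A γ →
        ∃ c c' : ℝ, 0 ≤ c ∧ 0 ≤ c' ∧ γ = c • β + c' • β'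

/-- The rank two subsystem `R` cuts `β^⊥`: `β ∈ R` but `β` is not a fundamental
root of `R`. -/
def CutsPerp (n : ℕ) (d : Fin n → ℤ) (A : Fin n → Fin n → ℤ)
    (R : Set (Fin n → ℝ)) (β : Fin n → ℝ) : Prop :=
  IsRankTwo n d A R ∧ β ∈ R ∧ ¬ IsFundamentalIn n d A R β

section helpers

variable {n : ℕ} {d : Fin n → ℤ} {A : Fin n → Fin n → ℤ}

/-- the coroot functional -/
def cof (A : Fin n → Fin n → ℤ) (i : Fin n) (x : Fin n → ℝ) : ℝ := ∑ j, (A i j : ℝ) * x j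

lemma cof_sub (i : Fin n) (x y : Fin n → ℝ) : cof A i (x - y) = cof A i x - cof A i y := by
  simp [cof, mul_sub, Finset.sum_sub_distrib]

lemma cof_add (i : Fin n) (x y : Fin n → ℝ) : cof A i (x + y) = cof A i x + cof A i y := by
  simp [cof, mul_add, Finset.sum_add_distrib]

lemma cof_smul (i : Fin n) (c : ℝ) (x : Fin n → ℝ) : cof A i (c • x) = c * cof A i x := by
  simp [cof, Finset.mul_sum, mul_left_comm]

lemma cof_sroot (i j : Fin n) : cof A i (sroot n j) = A i j := by
  simp [cof, sroot, Pi.single_apply]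

lemma refl_apply (hd : ∀ i, 0 < d i) (i : Fin n) (x : Fin n → ℝ) :
    simpleRefl n d A i x = x - cof A i x • sroot n i := by
  have h0 : (d i : ℝ) ≠ 0 := by exact_mod_cast (hd i).ne'
  have h : formL n d A (sroot n i) x = d i * cof A i x := by
    simp only [formL, LinearMap.sum_apply, LinearMap.smul_apply, LinearMap.smulRight_apply,
      LinearMap.proj_apply, smul_eq_mul, cof]
    rw [Finset.sum_eq_single i]
    · simp [sroot, Finset.mul_sum, mul_assoc]
    · intro b _ hb
      simp [sroot, Pi.single_apply, hb]
    · simp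
  simp only [simpleRefl, LinearMap.sub_apply, LinearMap.id_apply, LinearMap.smul_apply,
    LinearMap.smulRight_apply, h, smul_smul]
  rw [inv_mul_cancel_left₀ h0]

lemma refl_sroot (hd : ∀ i, 0 < d i) (i j : Fin n) :
    simpleRefl n d A i (sroot n j) = sroot n j - (A i j : ℝ) • sroot n i := by
  rw [refl_apply hd, cof_sroot]

lemma refl_self (hd : ∀ i, 0 < d i) (hdiag : ∀ i, A i i = 2) (i : Fin n) :
    simpleRefl n d A i (sroot n i) = - sroot n i := by
  rw [refl_sroot hd, hdiag]; push_cast; module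

lemma refl_refl (hd : ∀ i, 0 < d i) (hdiag : ∀ i, A i i = 2) (i : Fin n) (x : Fin n → ℝ) :
    simpleRefl n d A i (simpleRefl n d A i x) = x := by
  rw [refl_apply hd i x, map_sub, map_smul, refl_self hd hdiag, refl_apply hd i x]; module

lemma refl_sq (hd : ∀ i, 0 < d i) (hdiag : ∀ i, A i i = 2) (i : Fin n) :
    simpleRefl n d A i * simpleRefl n d A i = 1 := by
  exact LinearMap.ext fun x => refl_refl hd hdiag i x

/-- product of a word, leftmost letter applied last -/
def wp (n : ℕ) (d : Fin n → ℤ) (A : Fin n → Fin n → ℤ) (l : List (Fin n)) :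
    Module.End ℝ (Fin n → ℝ) := (l.map (simpleRefl n d A)).prod

lemma wp_nil : wp n d A [] = 1 := by simp [wp]
lemma wp_cons (i : Fin n) (l) : wp n d A (i :: l) = simpleRefl n d A i * wp n d A l := by simp [wp]
lemma wp_append (l l') : wp n d A (l ++ l') = wp n d A l * wp n d A l' := by simp [wp]

lemma wprod_eq (l) : wprod n d A l = wp n d A l.reverse := by simp [wprod, wp]

lemma isRoot_iff (β) : IsRoot n d A β ↔ ∃ l i, β = wp n d A l (sroot n i) := by
  constructor
  · rintro ⟨l, i, h⟩; exact ⟨l.reverse, i, by rw [← wprod_eq, h]⟩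
  · rintro ⟨l, i, h⟩; exact ⟨l.reverse, i, by rw [wprod_eq, List.reverse_reverse, h]⟩

lemma isRoot_sroot (i) : IsRoot n d A (sroot n i) :=
  (isRoot_iff _).2 ⟨[], i, by simp [wp_nil]⟩

lemma isRoot_refl {β} (h : IsRoot n d A β) (i) : IsRoot n d A (simpleRefl n d A i β) := by
  obtain ⟨l, j, rfl⟩ := (isRoot_iff _).1 h
  exact (isRoot_iff _).2 ⟨i :: l, j, by simp [wp_cons]⟩

lemma wp_rev_mul (hd : ∀ i, 0 < d i) (hdiag : ∀ i, A i i = 2) (l) :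
    wp n d A l.reverse * wp n d A l = 1 := by
  induction l with
  | nil => simp [wp_nil]
  | cons i l ih =>
    rw [List.reverse_cons, wp_append, wp_cons, wp_cons, wp_nil, mul_one]
    calc _ = wp n d A l.reverse * (simpleRefl n d A i * simpleRefl n d A i) * wp n d A l := by
          simp only [mul_assoc]
      _ = 1 := by rw [refl_sq hd hdiag, mul_one, ih]

/-- the alternating word of length k ending in j -/
def altw (i j : Fin n) : ℕ → List (Fin n)
  | 0 => []
  | k + 1 => (if Even k then j else i) :: altw i j k

lemma altw_length (i j : Fin n) (k) : (altw i j k).length = k := by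
  induction k with
  | zero => rfl
  | succ k ih => simp [altw, ih]

/-- conditions on a dihedral word -/
def DC (n : ℕ) (d : Fin n → ℤ) (A : Fin n → Fin n → ℤ) (i j : Fin n) (u : List (Fin n)) : Prop :=
  (∀ x ∈ u, x = i ∨ x = j) ∧
  (∀ l : List (Fin n), (∀ x ∈ l, x = i ∨ x = j) → wp n d A l = wp n d A u → u.length ≤ l.length) ∧
  (∀ l : List (Fin n), (∀ x ∈ l, x = i ∨ x = j) →
    wp n d A l = wp n d A u * simpleRefl n d A i → u.length ≤ l.length)

lemma DC.tail {i j x : Fin n} {u : List (Fin n)} (h : DC n d A i j (x :: u)) : DC n d A i j u := by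
  obtain ⟨h1, h2, h3⟩ := h
  refine ⟨fun y hy => h1 y (by simp [hy]), fun l hl e => ?_, fun l hl e => ?_⟩
  · have := h2 (x :: l) (by
      intro y hy; rcases List.mem_cons.1 hy with rfl | hy
      · exact h1 _ (by simp)
      · exact hl y hy) (by rw [wp_cons, wp_cons, e])
    simpa using this
  · have := h3 (x :: l) (by
      intro y hy; rcases List.mem_cons.1 hy with rfl | hy
      · exact h1 _ (by simp)
      · exact hl y hy) (by rw [wp_cons, wp_cons, e, mul_assoc])
    simpa using this

lemma DC.eq_altw (hd : ∀ i, 0 < d i) (hdiag : ∀ i, A i i = 2) {i j : Fin n} {u : List (Fin n)}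
    (h : DC n d A i j u) : u = altw i j u.length := by
  induction u with
  | nil => rfl
  | cons x u ih =>
    have hu := ih h.tail
    rw [List.length_cons, altw, ← hu]
    congr 1
    have hx := h.1 x (by simp)
    by_contra hne
    cases u with
    | nil =>
      simp at hne
      have hxi : x = i := by tauto
      subst hxi
      have := h.2.2 [] (by simp) (by rw [wp_cons, wp_nil, mul_one, refl_sq hd hdiag])
      simp at this
    | cons y u =>
      have hy : x = y := by
        simp only [List.length_cons, altw, List.cons.injEq] at hu
        rw [hu.1]
        simp only [List.length_cons, Nat.even_add_one] at hne
        by_cases he : Even u.length <;> simp [he] at hne ⊢ <;> tauto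
      subst hy
      have := h.2.1 u (fun z hz => h.1 z (by simp [hz])) (by
        rw [wp_cons, wp_cons, ← mul_assoc, refl_sq hd hdiag, one_mul])
      simp at this

lemma DC.mono {i j : Fin n} {k m : ℕ} (hmk : m ≤ k) (h : DC n d A i j (altw i j k)) :
    DC n d A i j (altw i j m) := by
  induction k, hmk using Nat.le_induction with
  | base => exact h
  | succ k _ ih => exact ih h.tail

lemma DC.lt_of_braid {i j : Fin n} {k m : ℕ} (h : DC n d A i j (altw i j k))
    (l : List (Fin n)) (hl : ∀ x ∈ l, x = i ∨ x = j) (hlm : l.length < m)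
    (e : wp n d A l = wp n d A (altw i j m) * simpleRefl n d A i) : k < m := by
  by_contra hc
  have := (h.mono (not_lt.1 hc)).2.2 l hl e
  rw [altw_length] at this
  omega

lemma comb_i (hd : ∀ i, 0 < d i) (hdiag : ∀ i, A i i = 2) (i j : Fin n) (x y : ℝ) :
    simpleRefl n d A i (x • sroot n i + y • sroot n j)
      = (-x - A i j * y) • sroot n i + y • sroot n j := by
  rw [map_add, map_smul, map_smul, refl_self hd hdiag, refl_sroot hd]; module

lemma comb_j (hd : ∀ i, 0 < d i) (hdiag : ∀ i, A i i = 2) (i j : Fin n) (x y : ℝ) :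
    simpleRefl n d A j (x • sroot n i + y • sroot n j)
      = x • sroot n i + (-y - A j i * x) • sroot n j := by
  rw [map_add, map_smul, map_smul, refl_self hd hdiag, refl_sroot hd]; module

lemma alt_infinite (hd : ∀ i, 0 < d i) (hdiag : ∀ i, A i i = 2) (i j : Fin n)
    (ha : A i j ≤ 0) (hb : A j i ≤ 0) (hab : 4 ≤ A i j * A j i) (k : ℕ) :
    ∃ x y : ℝ, 0 ≤ x ∧ 0 ≤ y ∧
      wp n d A (altw i j k) (sroot n i) = x • sroot n i + y • sroot n j ∧
      (Even k → 2 * y ≤ - A j i * x) ∧ (¬ Even k → 2 * x ≤ - A i j * y) := by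
  have ha' : (A i j : ℝ) ≤ 0 := by exact_mod_cast ha
  have hb' : (A j i : ℝ) ≤ 0 := by exact_mod_cast hb
  have hab' : (4 : ℝ) ≤ A i j * A j i := by exact_mod_cast hab
  induction k with
  | zero => exact ⟨1, 0, by simp, by simp, by simp [altw, wp_nil], by simp [hb'], by simp⟩
  | succ k ih =>
    obtain ⟨x, y, hx, hy, e, h1, h2⟩ := ih
    by_cases hk : Even k
    · have h1 := h1 hk
      refine ⟨x, -y - A j i * x, hx, by linarith, ?_, ?_, ?_⟩
      · simp only [altw, hk, if_true, wp_cons, Module.End.mul_apply, e]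
        rw [comb_j hd hdiag]
      · intro h; exact absurd hk (Nat.even_add_one.1 h)
      · intro _
        nlinarith [mul_nonneg (neg_nonneg.2 ha') (sub_nonneg.2 h1),
          mul_nonneg hx (sub_nonneg.2 hab')]
    · have h2 := h2 hk
      refine ⟨-x - A i j * y, y, by linarith, hy, ?_, ?_, ?_⟩
      · simp only [altw, hk, if_false, wp_cons, Module.End.mul_apply, e]
        rw [comb_i hd hdiag]
      · intro _
        nlinarith [mul_nonneg (neg_nonneg.2 hb') (sub_nonneg.2 h2),
          mul_nonneg hy (sub_nonneg.2 hab')]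
      · intro h; exact absurd (Nat.even_add_one.2 hk) h

lemma dihedral (hd : ∀ i, 0 < d i) (hdiag : ∀ i, A i i = 2)
    (hoff : ∀ i j, i ≠ j → A i j ≤ 0) (hsym : ∀ i j, d i * A i j = d j * A j i)
    {i j : Fin n} (hij : i ≠ j) {u : List (Fin n)} (h : DC n d A i j u) :
    ∃ x y : ℝ, 0 ≤ x ∧ 0 ≤ y ∧
      wp n d A u (sroot n i) = x • sroot n i + y • sroot n j := by
  have ha := hoff i j hij
  have hb := hoff j i hij.symm
  have hu := h.eq_altw hd hdiag
  generalize u.length = k at hu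
  subst hu
  by_cases hab : 4 ≤ A i j * A j i
  · obtain ⟨x, y, hx, hy, e, -⟩ := alt_infinite hd hdiag i j ha hb hab k
    exact ⟨x, y, hx, hy, e⟩
  have hs := hsym i j
  have hdi := hd i
  have hdj := hd j
  have h2i := hdiag i
  have h2j := hdiag j
  have hcases : (A i j = 0 ∧ A j i = 0) ∨ (A i j = -1 ∧ A j i = -1) ∨ (A i j = -1 ∧ A j i = -2) ∨
      (A i j = -2 ∧ A j i = -1) ∨ (A i j = -1 ∧ A j i = -3) ∨ (A i j = -3 ∧ A j i = -1) := by
    by_cases h0 : A i j = 0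
    · left; refine ⟨h0, ?_⟩
      rw [h0, mul_zero] at hs
      rcases mul_eq_zero.1 hs.symm with h | h
      · omega
      · exact h
    by_cases h0' : A j i = 0
    · exfalso
      rw [h0', mul_zero] at hs
      rcases mul_eq_zero.1 hs with h | h
      · omega
      · exact h0 h
    have h1 : A i j ≤ -1 := by omega
    have h1' : A j i ≤ -1 := by omega
    have h3 : -3 ≤ A i j := by nlinarith
    have h3' : -3 ≤ A j i := by nlinarith
    generalize A i j = a at *
    generalize A j i = b at *
    interval_cases a <;> interval_cases b <;> simp_all
  have start : wp n d A (altw i j 0) (sroot n i) = (1 : ℝ) • sroot n i + (0 : ℝ) • sroot n j := by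
    simp [altw, wp_nil]
  have stepE : ∀ (k : ℕ) (x y : ℝ), Even k →
      wp n d A (altw i j k) (sroot n i) = x • sroot n i + y • sroot n j →
      wp n d A (altw i j (k+1)) (sroot n i) = x • sroot n i + (-y - A j i * x) • sroot n j := by
    intro k x y hk e
    simp only [altw, hk, if_true, wp_cons, Module.End.mul_apply, e]
    rw [comb_j hd hdiag]
  have stepO : ∀ (k : ℕ) (x y : ℝ), ¬ Even k →
      wp n d A (altw i j k) (sroot n i) = x • sroot n i + y • sroot n j →
      wp n d A (altw i j (k+1)) (sroot n i) = (-x - A i j * y) • sroot n i + y • sroot n j := by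
    intro k x y hk e
    simp only [altw, hk, if_false, wp_cons, Module.End.mul_apply, e]
    rw [comb_i hd hdiag]
  have e1 := stepE 0 _ _ (by decide) start
  have e2 := stepO 1 _ _ (by decide) e1
  have e3 := stepE 2 _ _ (by decide) e2
  have e4 := stepO 3 _ _ (by decide) e3
  have e5 := stepE 4 _ _ (by decide) e4
  have fin : ∀ m, ∀ l : List (Fin n), (∀ x ∈ l, x = i ∨ x = j) → l.length < m →
      (∀ v, wp n d A l v = wp n d A (altw i j m) (simpleRefl n d A i v)) → k < m :=
    fun m l hl hlm e => h.lt_of_braid l hl hlm (LinearMap.ext e)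
  rcases hcases with ⟨p, q⟩ | ⟨p, q⟩ | ⟨p, q⟩ | ⟨p, q⟩ | ⟨p, q⟩ | ⟨p, q⟩
  · have : k < 2 := fin 2 [j] (by simp) (by simp) (by
      intro v
      simp [altw, wp, Nat.even_add_one, refl_apply hd, cof_sub, cof_smul, cof_sroot, p, q, h2i, h2j]
      module)
    interval_cases k
    · exact ⟨_, _, by norm_num [p, q], by norm_num [p, q], start⟩
    · exact ⟨_, _, by norm_num [p, q], by norm_num [p, q], e1⟩
  · have : k < 3 := fin 3 [i, j] (by simp) (by simp) (by
      intro v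
      simp [altw, wp, Nat.even_add_one, refl_apply hd, cof_sub, cof_smul, cof_sroot, p, q, h2i, h2j]
      module)
    interval_cases k
    · exact ⟨_, _, by norm_num [p, q], by norm_num [p, q], start⟩
    · exact ⟨_, _, by norm_num [p, q], by norm_num [p, q], e1⟩
    · exact ⟨_, _, by norm_num [p, q], by norm_num [p, q], e2⟩
  · have : k < 4 := fin 4 [j, i, j] (by simp) (by simp) (by
      intro v
      simp [altw, wp, Nat.even_add_one, refl_apply hd, cof_sub, cof_smul, cof_sroot, p, q, h2i, h2j]
      module)
    interval_cases k
    · exact ⟨_, _, by norm_num [p, q], by norm_num [p, q], start⟩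
    · exact ⟨_, _, by norm_num [p, q], by norm_num [p, q], e1⟩
    · exact ⟨_, _, by norm_num [p, q], by norm_num [p, q], e2⟩
    · exact ⟨_, _, by norm_num [p, q], by norm_num [p, q], e3⟩
  · have : k < 4 := fin 4 [j, i, j] (by simp) (by simp) (by
      intro v
      simp [altw, wp, Nat.even_add_one, refl_apply hd, cof_sub, cof_smul, cof_sroot, p, q, h2i, h2j]
      module)
    interval_cases k
    · exact ⟨_, _, by norm_num [p, q], by norm_num [p, q], start⟩
    · exact ⟨_, _, by norm_num [p, q], by norm_num [p, q], e1⟩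
    · exact ⟨_, _, by norm_num [p, q], by norm_num [p, q], e2⟩
    · exact ⟨_, _, by norm_num [p, q], by norm_num [p, q], e3⟩
  · have : k < 6 := fin 6 [j, i, j, i, j] (by simp) (by simp) (by
      intro v
      simp [altw, wp, Nat.even_add_one, refl_apply hd, cof_sub, cof_smul, cof_sroot, p, q, h2i, h2j]
      module)
    interval_cases k
    · exact ⟨_, _, by norm_num [p, q], by norm_num [p, q], start⟩
    · exact ⟨_, _, by norm_num [p, q], by norm_num [p, q], e1⟩
    · exact ⟨_, _, by norm_num [p, q], by norm_num [p, q], e2⟩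
    · exact ⟨_, _, by norm_num [p, q], by norm_num [p, q], e3⟩
    · exact ⟨_, _, by norm_num [p, q], by norm_num [p, q], e4⟩
    · exact ⟨_, _, by norm_num [p, q], by norm_num [p, q], e5⟩
  · have : k < 6 := fin 6 [j, i, j, i, j] (by simp) (by simp) (by
      intro v
      simp [altw, wp, Nat.even_add_one, refl_apply hd, cof_sub, cof_smul, cof_sroot, p, q, h2i, h2j]
      module)
    interval_cases k
    · exact ⟨_, _, by norm_num [p, q], by norm_num [p, q], start⟩
    · exact ⟨_, _, by norm_num [p, q], by norm_num [p, q], e1⟩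
    · exact ⟨_, _, by norm_num [p, q], by norm_num [p, q], e2⟩
    · exact ⟨_, _, by norm_num [p, q], by norm_num [p, q], e3⟩
    · exact ⟨_, _, by norm_num [p, q], by norm_num [p, q], e4⟩
    · exact ⟨_, _, by norm_num [p, q], by norm_num [p, q], e5⟩

lemma sroot_nonneg (i k : Fin n) : 0 ≤ sroot n i k := by
  simp only [sroot, Pi.single_apply]; split_ifs <;> norm_num

lemma pos_of_len (hd : ∀ i, 0 < d i) (hdiag : ∀ i, A i i = 2)
    (hoff : ∀ i j, i ≠ j → A i j ≤ 0) (hsym : ∀ i j, d i * A i j = d j * A j i) (N : ℕ) :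
    ∀ (l : List (Fin n)) (i : Fin n), l.length = N →
      (∀ l', wp n d A l' = wp n d A l → N ≤ l'.length) →
      (∀ l', wp n d A l' = wp n d A l * simpleRefl n d A i → N ≤ l'.length) →
      ∀ k, 0 ≤ wp n d A l (sroot n i) k := by
  induction N using Nat.strong_induction_on with
  | _ N ih =>
  intro l i hlN hred hlen k
  rcases List.eq_nil_or_concat l with rfl | ⟨l0, j, hl0⟩
  · simpa [wp_nil] using sroot_nonneg i k
  rw [List.concat_eq_append] at hl0
  have hl0N : l0.length + 1 = N := by rw [← hlN, hl0]; simp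
  have hij : i ≠ j := by
    rintro rfl
    have := hlen l0 (by
      rw [hl0, wp_append, wp_cons, wp_nil, mul_one, mul_assoc, refl_sq hd hdiag, mul_one])
    omega
  let Q : ℕ → Prop := fun m => ∃ v u : List (Fin n), v.length = m ∧ (∀ x ∈ u, x = i ∨ x = j) ∧
    v.length + u.length = N ∧ wp n d A v * wp n d A u = wp n d A l
  have hQ0 : Q l0.length := ⟨l0, [j], rfl, by simp, by simpa using hl0N, by
    rw [hl0, wp_append]⟩
  classical
  have hQ : ∃ m, Q m := ⟨_, hQ0⟩
  obtain ⟨v, u, hvm, hu, hvu, e⟩ := Nat.find_spec hQ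
  have hmin : ∀ m, Q m → v.length ≤ m := fun m hm => by rw [hvm]; exact Nat.find_min' hQ hm
  have hvN : v.length < N := by have := hmin _ hQ0; omega
  have hvred : ∀ l', wp n d A l' = wp n d A v → v.length ≤ l'.length := by
    intro l' h'
    have := hred (l' ++ u) (by rw [wp_append, h', e])
    simp at this; omega
  have hvlen : ∀ x, (x = i ∨ x = j) → ∀ l', wp n d A l' = wp n d A v * simpleRefl n d A x →
      v.length ≤ l'.length := by
    intro x hx l' h'
    by_contra hc
    have e' : wp n d A l' * wp n d A (x :: u) = wp n d A l := by
      rw [h', wp_cons, ← e]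
      calc _ = wp n d A v * (simpleRefl n d A x * simpleRefl n d A x) * wp n d A u := by
            simp only [mul_assoc]
        _ = _ := by rw [refl_sq hd hdiag, mul_one]
    have h1 := hred (l' ++ (x :: u)) (by rw [wp_append, e'])
    simp at h1
    have := hmin l'.length ⟨l', x :: u, rfl, by
      intro y hy
      rcases List.mem_cons.1 hy with rfl | hy
      · exact hx
      · exact hu y hy, by simp; omega, e'⟩
    omega
  have hvi := ih _ hvN v i rfl hvred (hvlen i (Or.inl rfl)) k
  have hvj := ih _ hvN v j rfl hvred (hvlen j (Or.inr rfl)) k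
  have hDC : DC n d A i j u := by
    refine ⟨hu, fun l' _ h' => ?_, fun l' _ h' => ?_⟩
    · have := hred (v ++ l') (by rw [wp_append, h', e])
      simp at this; omega
    · have := hlen (v ++ l') (by rw [wp_append, h', ← mul_assoc, e])
      simp at this; omega
  obtain ⟨x, y, hx, hy, e2⟩ := dihedral hd hdiag hoff hsym hij hDC
  rw [← e, Module.End.mul_apply, e2, map_add, map_smul, map_smul]
  simp only [Pi.add_apply, Pi.smul_apply, smul_eq_mul]
  positivity

lemma exists_reduced (w : List (Fin n)) : ∃ l, wp n d A l = wp n d A w ∧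
    ∀ l', wp n d A l' = wp n d A l → l.length ≤ l'.length := by
  classical
  have hQ : ∃ m, ∃ l : List (Fin n), l.length = m ∧ wp n d A l = wp n d A w := ⟨_, w, rfl, rfl⟩
  obtain ⟨l, hl, e⟩ := Nat.find_spec hQ
  exact ⟨l, e, fun l' h' => by rw [hl]; exact Nat.find_min' hQ ⟨l', rfl, h'.trans e⟩⟩

lemma root_pos_or_neg (hd : ∀ i, 0 < d i) (hdiag : ∀ i, A i i = 2)
    (hoff : ∀ i j, i ≠ j → A i j ≤ 0) (hsym : ∀ i j, d i * A i j = d j * A j i)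
    {β : Fin n → ℝ} (h : IsRoot n d A β) : (∀ k, 0 ≤ β k) ∨ (∀ k, β k ≤ 0) := by
  obtain ⟨w, i, rfl⟩ := (isRoot_iff _).1 h
  obtain ⟨l, e, hl⟩ := exists_reduced (d := d) (A := A) w
  rw [← e]
  by_cases hc : ∀ l', wp n d A l' = wp n d A l * simpleRefl n d A i → l.length ≤ l'.length
  · left; exact pos_of_len hd hdiag hoff hsym _ l i rfl hl hc
  · right
    push Not at hc
    obtain ⟨l', e', hl'⟩ := hc
    obtain ⟨l2, e2, hl2⟩ := exists_reduced (d := d) (A := A) l'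
    have hs : wp n d A l2 * simpleRefl n d A i = wp n d A l := by
      rw [e2, e', mul_assoc, refl_sq hd hdiag, mul_one]
    have h3 := hl2 l' e2.symm
    have := pos_of_len hd hdiag hoff hsym _ l2 i rfl hl2 (by
      intro l3 e3
      have := hl l3 (by rw [e3, hs])
      omega)
    intro k
    have hk := this k
    rw [← hs, Module.End.mul_apply, refl_self hd hdiag, map_neg, Pi.neg_apply]
    linarith

lemma wp_int (hd : ∀ i, 0 < d i) (l : List (Fin n)) (i : Fin n) :
    ∀ k, ∃ z : ℤ, wp n d A l (sroot n i) k = z := by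
  induction l with
  | nil =>
    intro k
    exact ⟨if k = i then 1 else 0, by simp [wp_nil, sroot, Pi.single_apply]⟩
  | cons j l ih =>
    intro k
    choose z hz using ih
    rw [wp_cons, Module.End.mul_apply, refl_apply hd]
    refine ⟨z k - (∑ m, A j m * z m) * (if k = j then 1 else 0), ?_⟩
    simp only [cof, hz, Pi.sub_apply, Pi.smul_apply, smul_eq_mul]
    simp [sroot, Pi.single_apply]

lemma root_smul (hd : ∀ i, 0 < d i) (hdiag : ∀ i, A i i = 2) {i : Fin n} {c : ℝ} (hc : 0 ≤ c)
    (h : IsRoot n d A (c • sroot n i)) : c = 1 := by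
  obtain ⟨l, j, e⟩ := (isRoot_iff _).1 h
  obtain ⟨z, hz⟩ := wp_int (A := A) hd l j i
  rw [← e] at hz
  simp [sroot] at hz
  have e2 : sroot n j = c • wp n d A l.reverse (sroot n i) := by
    rw [← map_smul, e, ← Module.End.mul_apply, wp_rev_mul hd hdiag]; rfl
  obtain ⟨y, hy⟩ := wp_int (A := A) hd l.reverse i j
  have e3 := congrFun e2 j
  rw [Pi.smul_apply, hy, hz] at e3
  simp [sroot] at e3
  have e4 : z * y = 1 := by exact_mod_cast e3.symm
  rw [hz] at hc ⊢
  have hz0 : 0 ≤ z := by exact_mod_cast hc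
  have := Int.eq_one_or_neg_one_of_mul_eq_one e4
  have : z = 1 := by omega
  rw [this]; norm_num

lemma pos_refl (hd : ∀ i, 0 < d i) (hdiag : ∀ i, A i i = 2)
    (hoff : ∀ i j, i ≠ j → A i j ≤ 0) (hsym : ∀ i j, d i * A i j = d j * A j i)
    {γ : Fin n → ℝ} (h : IsPosRoot n d A γ) {i : Fin n} (hne : γ ≠ sroot n i) :
    IsPosRoot n d A (simpleRefl n d A i γ) := by
  have hr := isRoot_refl h.1 i
  refine ⟨hr, ?_⟩
  rcases root_pos_or_neg hd hdiag hoff hsym hr with h1 | h1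
  · exact h1
  exfalso
  have hz : ∀ k, k ≠ i → γ k = 0 := by
    intro k hk
    have := h1 k
    rw [refl_apply hd] at this
    simp [sroot, Pi.single_apply, hk] at this
    exact le_antisymm this (h.2 k)
  have e : γ = γ i • sroot n i := by
    ext k
    by_cases hk : k = i
    · subst hk; simp [sroot]
    · simp [sroot, hz k hk, Pi.single_apply, hk]
  have h1 := root_smul hd hdiag (h.2 i) (e ▸ h.1)
  rw [h1, one_smul] at e
  exact hne e

lemma image_rankTwo (hd : ∀ i, 0 < d i) (hdiag : ∀ i, A i i = 2) {R : Set (Fin n → ℝ)}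
    (h : IsRankTwo n d A R) (i : Fin n) : IsRankTwo n d A (simpleRefl n d A i '' R) := by
  obtain ⟨L, h1, h2, h3⟩ := h
  have hinj : Function.Injective (simpleRefl n d A i) :=
    Function.LeftInverse.injective (refl_refl hd hdiag i)
  refine ⟨L.map (simpleRefl n d A i), ?_, ?_, ?_⟩
  · rw [← h1]
    exact (LinearEquiv.finrank_eq (Submodule.equivMapOfInjective _ hinj L)).symm
  · ext x
    rw [h2]
    constructor
    · rintro ⟨y, ⟨hy, hyL⟩, rfl⟩
      exact ⟨isRoot_refl hy i, y, hyL, rfl⟩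
    · rintro ⟨hx, y, hyL, rfl⟩
      refine ⟨y, ⟨?_, hyL⟩, rfl⟩
      have := isRoot_refl hx i
      rwa [refl_refl hd hdiag] at this
  · rw [← h3, Submodule.map_span]

lemma image_image (hd : ∀ i, 0 < d i) (hdiag : ∀ i, A i i = 2) (R : Set (Fin n → ℝ))
    (i : Fin n) : simpleRefl n d A i '' (simpleRefl n d A i '' R) = R := by
  rw [Set.image_image]; simp [refl_refl hd hdiag]

lemma neg_mem {R : Set (Fin n → ℝ)} (hd : ∀ i, 0 < d i) (hdiag : ∀ i, A i i = 2)
    (h : IsRankTwo n d A R) {i : Fin n} (hi : - sroot n i ∈ R) : sroot n i ∈ R := by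
  obtain ⟨L, h1, h2, h3⟩ := h
  rw [h2] at hi ⊢
  exact ⟨isRoot_sroot i, by simpa using L.neg_mem hi.2⟩

lemma fund_image (hd : ∀ i, 0 < d i) (hdiag : ∀ i, A i i = 2)
    (hoff : ∀ i j, i ≠ j → A i j ≤ 0) (hsym : ∀ i j, d i * A i j = d j * A j i)
    {R : Set (Fin n → ℝ)} {i : Fin n} (hR : IsRankTwo n d A R) (hi : sroot n i ∉ R)
    {β : Fin n → ℝ} (h : IsFundamentalIn n d A R β) :
    IsFundamentalIn n d A (simpleRefl n d A i '' R) (simpleRefl n d A i β) := by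
  obtain ⟨h1, h2, γ, h3, h4, h5, h6⟩ := h
  have key : ∀ x ∈ R, IsPosRoot n d A x → IsPosRoot n d A (simpleRefl n d A i x) := by
    intro x hx hp
    exact pos_refl hd hdiag hoff hsym hp (fun e => hi (e ▸ hx))
  refine ⟨⟨β, h1, rfl⟩, key β h1 h2, _, ⟨γ, h3, rfl⟩, key γ h3 h4, ?_, ?_⟩
  · intro e
    exact h5 (Function.LeftInverse.injective (refl_refl hd hdiag i) e)
  · rintro _ ⟨x, hx, rfl⟩ hp
    have hp' : IsPosRoot n d A x := by
      have := pos_refl hd hdiag hoff hsym hp (i := i) (by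
        intro e
        apply hi
        apply neg_mem hd hdiag hR
        rw [← refl_self (d := d) (A := A) hd hdiag, ← e, refl_refl hd hdiag]
        exact hx)
      rwa [refl_refl hd hdiag] at this
    obtain ⟨c, c', hc, hc', e⟩ := h6 x hx hp'
    exact ⟨c, c', hc, hc', by rw [e]; simp⟩

lemma not_mem_image {R : Set (Fin n → ℝ)} (hd : ∀ i, 0 < d i) (hdiag : ∀ i, A i i = 2)
    (h : IsRankTwo n d A R) {i : Fin n} (hi : sroot n i ∉ R) :
    sroot n i ∉ simpleRefl n d A i '' R := by
  rintro ⟨x, hx, e⟩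
  apply hi
  apply neg_mem hd hdiag h
  rw [← refl_self (d := d) (A := A) hd hdiag, ← e, refl_refl hd hdiag]
  exact hx

lemma cuts_image (hd : ∀ i, 0 < d i) (hdiag : ∀ i, A i i = 2)
    (hoff : ∀ i j, i ≠ j → A i j ≤ 0) (hsym : ∀ i j, d i * A i j = d j * A j i)
    {R : Set (Fin n → ℝ)} {i : Fin n} (hi : sroot n i ∉ R)
    {β : Fin n → ℝ} (h : CutsPerp n d A R β) :
    CutsPerp n d A (simpleRefl n d A i '' R) (simpleRefl n d A i β) := by
  obtain ⟨h1, h2, h3⟩ := h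
  have hr := image_rankTwo hd hdiag h1 i
  refine ⟨hr, ⟨β, h2, rfl⟩, fun hf => h3 ?_⟩
  have := fund_image hd hdiag hoff hsym hr (not_mem_image hd hdiag h1 hi) hf
  rwa [image_image hd hdiag, refl_refl hd hdiag] at this

lemma rankTwo_eq {R : Set (Fin n → ℝ)} (h : IsRankTwo n d A R) {x y : Fin n → ℝ}
    (hx : x ∈ R) (hy : y ∈ R) (hli : LinearIndependent ℝ ![x, y]) :
    R = {x | IsRoot n d A x} ∩ (Submodule.span ℝ ({x, y} : Set (Fin n → ℝ)) : Set (Fin n → ℝ)) := by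
  obtain ⟨L, h1, h2, h3⟩ := h
  have hle : Submodule.span ℝ ({x, y} : Set (Fin n → ℝ)) ≤ L := by
    rw [Submodule.span_le]
    rw [h2] at hx hy
    rintro z (rfl | rfl)
    exacts [hx.2, hy.2]
  have hf := finrank_span_eq_card hli
  rw [Matrix.range_cons_cons_empty] at hf
  have := Submodule.eq_of_le_of_finrank_eq hle (by rw [h1]; simpa using hf)
  rw [this]; exact h2

end helpers

/-- if `β` is a positive root and `s i β - β ∈ ℝ_{>0} • α i`, then the
rank two subsystems cutting `(s i β)^⊥` are exactly the images `s i (R)` of rank two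
subsystems `R` cutting `β^⊥`, together with the single subsystem `Φ ∩ span(α i, β)`. -/
theorem stmt8 (n : ℕ) (hn : 1 ≤ n) (d : Fin n → ℤ) (A : Fin n → Fin n → ℤ)
    (hd : ∀ i, 0 < d i) (hdiag : ∀ i, A i i = 2)
    (hoff : ∀ i j, i ≠ j → A i j ≤ 0)
    (hsym : ∀ i j, d i * A i j = d j * A j i)
    (β : Fin n → ℝ) (hβ : IsPosRoot n d A β) (i : Fin n)
    (hcov : ∃ c : ℝ, 0 < c ∧ simpleRefl n d A i β - β = c • sroot n i) :
    {R | CutsPerp n d A R (simpleRefl n d A i β)}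
      = ((fun R => (simpleRefl n d A i) '' R) '' {R | CutsPerp n d A R β})
        ∪ {({x | IsRoot n d A x} ∩
            (Submodule.span ℝ ({sroot n i, β} : Set (Fin n → ℝ)) : Set (Fin n → ℝ)))} := by
  obtain ⟨c, hc, hcβ⟩ := hcov
  have hsβ : simpleRefl n d A i β = β + c • sroot n i := by rw [← hcβ]; abel
  have hne : ∀ t : ℝ, β ≠ t • sroot n i := by
    intro t ht
    have ht0 : 0 ≤ t := by
      have := hβ.2 i
      rw [ht] at this
      simpa [sroot] using this
    have h1 := root_smul hd hdiag ht0 (ht ▸ hβ.1)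
    rw [ht, h1, one_smul, refl_self hd hdiag] at hsβ
    have := congrFun hsβ i
    simp [sroot] at this
    linarith
  have hli : LinearIndependent ℝ ![sroot n i, β] := by
    rw [LinearIndependent.pair_iff' (by
      intro h; have := congrFun h i; simp [sroot] at this)]
    intro a ha
    exact hne a ha.symm
  have hposβ' : IsPosRoot n d A (simpleRefl n d A i β) :=
    pos_refl hd hdiag hoff hsym hβ (by simpa using hne 1)
  set R0 : Set (Fin n → ℝ) := {x | IsRoot n d A x} ∩
            (Submodule.span ℝ ({sroot n i, β} : Set (Fin n → ℝ)) : Set (Fin n → ℝ)) with hR0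
  have hα0 : sroot n i ∈ R0 := ⟨isRoot_sroot i, Submodule.subset_span (by simp)⟩
  have hβ0 : β ∈ R0 := ⟨hβ.1, Submodule.subset_span (by simp)⟩
  have hβ'0 : simpleRefl n d A i β ∈ R0 := by
    refine ⟨hposβ'.1, ?_⟩
    rw [hsβ]
    exact Submodule.add_mem _ hβ0.2 (Submodule.smul_mem _ _ hα0.2)
  have hR2 : IsRankTwo n d A R0 := by
    refine ⟨_, ?_, hR0, ?_⟩
    · have hf := finrank_span_eq_card hli
      rw [Matrix.range_cons_cons_empty] at hf
      simpa using hf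
    · apply le_antisymm
      · rw [Submodule.span_le]; exact Set.inter_subset_right
      · apply Submodule.span_mono
        rintro z (rfl | rfl)
        exacts [hα0, hβ0]
  have hcut0 : CutsPerp n d A R0 (simpleRefl n d A i β) := by
    refine ⟨hR2, hβ'0, ?_⟩
    rintro ⟨-, -, γ, hγ, hγp, hγne, hall⟩
    obtain ⟨x, y, hx, hy, e1⟩ := hall β hβ0 hβ
    obtain ⟨z, w, hz, hw, e2⟩ := hall (sroot n i) hα0 ⟨isRoot_sroot i, sroot_nonneg i⟩
    set δ := simpleRefl n d A i β with hδ
    have e3 : (1 - x - c * z) • δ = (y + c * w) • γ := by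
      have : δ = (x • δ + y • γ) + c • (z • δ + w • γ) := by rw [← e1, ← e2, ← hsβ]
      linear_combination (norm := module) this
    have hdep : ∃ p q : ℝ, β = p • δ ∧ sroot n i = q • δ := by
      have hcw : 0 ≤ c * w := mul_nonneg hc.le hw
      by_cases h0 : y + c * w = 0
      · have hy0 : y = 0 := by linarith
        have hw0 : w = 0 := by
          have : c * w = 0 := by linarith
          rcases mul_eq_zero.1 this with h | h
          · linarith
          · exact h
        exact ⟨x, z, by rw [hy0] at e1; simpa using e1, by rw [hw0] at e2; simpa using e2⟩
      · have hγδ : γ = ((y + c * w)⁻¹ * (1 - x - c * z)) • δ := by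
          rw [mul_smul, e3, smul_smul, inv_mul_cancel₀ h0, one_smul]
        generalize (y + c * w)⁻¹ * (1 - x - c * z) = r at hγδ
        refine ⟨x + y * r, z + w * r, ?_, ?_⟩
        · rw [hγδ] at e1
          linear_combination (norm := module) e1
        · rw [hγδ] at e2
          linear_combination (norm := module) e2
    obtain ⟨p, q, hp, hq⟩ := hdep
    have hli2 := LinearIndependent.pair_iff.1 hli p (-q) (by
      linear_combination (norm := module) p • hq - q • hp)
    have hq0 : q = 0 := by linarith [hli2.2]
    rw [hq0, zero_smul] at hq
    have := congrFun hq i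
    simp [sroot] at this
  ext R
  simp only [Set.mem_ofPred_eq, Set.mem_union, Set.mem_image, Set.mem_singleton_iff]
  constructor
  · intro hR
    by_cases hi : sroot n i ∈ R
    · right
      apply rankTwo_eq hR.1 hi _ hli
      obtain ⟨L, h1, h2, h3⟩ := hR.1
      have hb := hR.2.1
      rw [h2] at hi hb ⊢
      refine ⟨hβ.1, ?_⟩
      have : β = simpleRefl n d A i β - c • sroot n i := by rw [hsβ]; abel
      rw [this]
      exact L.sub_mem hb.2 (L.smul_mem _ hi.2)
    · left
      refine ⟨_, ?_, image_image hd hdiag R i⟩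
      have := cuts_image hd hdiag hoff hsym hi hR
      rwa [refl_refl hd hdiag] at this
  · rintro (⟨R, hR, rfl⟩ | rfl)
    · by_cases hi : sroot n i ∈ R
      · have hr := image_rankTwo hd hdiag hR.1 i
        have e : simpleRefl n d A i '' R = R0 := by
          obtain ⟨L, h1, h2, h3⟩ := hr
          have ha : sroot n i ∈ simpleRefl n d A i '' R := by
            apply neg_mem hd hdiag ⟨L, h1, h2, h3⟩
            exact ⟨_, hi, refl_self hd hdiag i⟩
          apply rankTwo_eq ⟨L, h1, h2, h3⟩ ha _ hli
          have hb : simpleRefl n d A i β ∈ simpleRefl n d A i '' R := ⟨_, hR.2.1, rfl⟩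
          rw [h2] at ha hb ⊢
          refine ⟨hβ.1, ?_⟩
          have : β = simpleRefl n d A i β - c • sroot n i := by rw [hsβ]; abel
          rw [this]
          exact L.sub_mem hb.2 (L.smul_mem _ ha.2)
        rw [e]; exact hcut0
      · exact cuts_image hd hdiag hoff hsym hi hR
    · exact hcut0

end
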